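/- Let h : [0,∞) → ℝ be a bounded continuous function with ∫₀^∞ h(x) dx = 0 and ∫₀^∞ |x·h(x)| dx < ∞, and set H(y) = ∫₀^y h(s) ds. For θ in a neighborhood of 0 define g(x,θ) = e^{−x} + θ·h(x), G(y,θ) = 1 − e^{−y} + θ·H(y), and b(θ) = 1/4 − 6∫₀^∞ ∫₀^∞ g(x,θ)·G(y,θ)·(1 − G(y,θ))·g(y,θ)·(∫_{x+y}^∞ g(z,θ) dz) dy dx. Then b is differentiable at θ = 0 with b'(0) = ∫₀^∞ h(s)·(−1 + 2e^{−3s} − (9/2)e^{−2s} + (5/2)e^{−s}) ds = 5·∫₀^∞ ψ(s)·h(s) ds. -/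

import Mathlib

open Real MeasureTheory Set

/-- The projection `ψ` from the paper. -/
noncomputable def psi (s : ℝ) : ℝ :=
  -1/20 + (2/5) * exp (-(3*s)) - (9/10) * exp (-(2*s)) + (1/2) * exp (-s)

open Filter Topology

lemma aux_exp_pow_int (n : ℕ) (hn : 0 < n) : IntegrableOn (fun y : ℝ => exp (-y) ^ n) (Ioi 0) := by
  have h := exp_neg_integrableOn_Ioi 0 (b := (n : ℝ)) (by exact_mod_cast hn)
  refine h.congr_fun (fun y _ => ?_) measurableSet_Ioi
  simp only
  rw [← exp_nat_mul]; ring_nf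

lemma aux_exp_pow_val (n : ℕ) (hn : 0 < n) : ∫ y in Ioi (0:ℝ), exp (-y) ^ n = 1 / n := by
  have hn' : (0:ℝ) < n := by exact_mod_cast hn
  have h := integral_exp_mul_Ioi (a := -(n : ℝ)) (by linarith) 0
  rw [mul_zero, exp_zero, neg_div_neg_eq] at h
  rw [← h]
  refine setIntegral_congr_fun measurableSet_Ioi (fun y _ => ?_)
  rw [← exp_nat_mul]; ring_nf

lemma aux_exp_deriv (n : ℕ) (y : ℝ) :
    HasDerivAt (fun y : ℝ => exp (-y) ^ n) (-(n * exp (-y) ^ n)) y := by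
  have h : HasDerivAt (fun y : ℝ => exp (n * (-y))) (exp (n * (-y)) * (n * (-1))) y :=
    ((hasDerivAt_neg y).const_mul (n : ℝ)).exp
  simp only [exp_nat_mul] at h
  convert h using 1
  ring

lemma aux_exp_tendsto (n : ℕ) (hn : 0 < n) : Tendsto (fun y : ℝ => exp (-y) ^ n) atTop (𝓝 0) := by
  have := (tendsto_exp_neg_atTop_nhds_zero).pow n
  simpa [hn.ne'] using this

/-- bounded continuous times integrable -/
lemma aux_bdd_int {f H : ℝ → ℝ} {C : ℝ} (hf : IntegrableOn f (Ioi 0)) (Hc : Continuous H)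
    (hC : ∀ y, 0 ≤ y → |H y| ≤ C) : IntegrableOn (fun y => f y * H y) (Ioi 0) := by
  refine Integrable.mul_bdd (c := C) hf Hc.aestronglyMeasurable ?_
  filter_upwards [ae_restrict_mem measurableSet_Ioi] with y hy
  exact hC y (le_of_lt hy)

lemma aux_exp_bdd (n : ℕ) (y : ℝ) (hy : 0 ≤ y) : |exp (-y) ^ n| ≤ 1 := by
  rw [abs_of_nonneg (by positivity)]
  exact pow_le_one₀ (exp_nonneg _) (by rw [exp_le_one_iff]; linarith)

lemma aux_hexp_int {h : ℝ → ℝ} (hi : IntegrableOn h (Ioi 0)) (n : ℕ) :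
    IntegrableOn (fun y => h y * exp (-y) ^ n) (Ioi 0) :=
  aux_bdd_int hi (by fun_prop) (aux_exp_bdd n)

lemma aux_parts {h H : ℝ → ℝ} {C : ℝ} (hi : IntegrableOn h (Ioi 0))
    (hH : ∀ y, HasDerivAt H (h y) y) (H0 : H 0 = 0) (hC : ∀ y, 0 ≤ y → |H y| ≤ C)
    (n : ℕ) (hn : 0 < n) :
    ∫ y in Ioi (0:ℝ), exp (-y) ^ n * H y = 1 / n * ∫ y in Ioi (0:ℝ), h y * exp (-y) ^ n := by
  have hn' : (n : ℝ) ≠ 0 := by exact_mod_cast hn.ne'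
  have Hc : Continuous H := continuous_iff_continuousAt.2 fun y => (hH y).continuousAt
  have i1 := aux_hexp_int hi n
  have i2 := aux_bdd_int (aux_exp_pow_int n hn) Hc hC
  have key := integral_Ioi_of_hasDerivAt_of_tendsto' (a := 0) (m := 0)
    (f := fun y => H y * exp (-y) ^ n)
    (f' := fun y => h y * exp (-y) ^ n - n * (exp (-y) ^ n * H y))
    (fun y _ => by
      refine ((hH y).fun_mul (aux_exp_deriv n y)).congr_deriv ?_; ring)
    (i1.sub (i2.const_mul _)) (by
      refine (isBoundedUnder_le_mul_tendsto_zero ?_ (aux_exp_tendsto n hn))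
      refine isBoundedUnder_of_eventually_le (a := C) ?_
      filter_upwards [eventually_ge_atTop 0] with y hy using hC y hy)
  rw [integral_sub i1 (i2.const_mul _), integral_const_mul, H0] at key
  field_simp
  linarith

lemma aux_T3 {H : ℝ → ℝ} {C : ℝ} (Hc : Continuous H) (hC : ∀ y, 0 ≤ y → |H y| ≤ C) :
    ∫ y in Ioi (0:ℝ), (exp (-y) ^ 1 - exp (-y) ^ 2) * ∫ x in Ioi (0:ℝ), exp (-(x + y)) * H (x + y)
    = 1 / 2 * (∫ y in Ioi (0:ℝ), exp (-y) ^ 1 * H y) - (∫ y in Ioi (0:ℝ), exp (-y) ^ 2 * H y)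
      + 1 / 2 * ∫ y in Ioi (0:ℝ), exp (-y) ^ 3 * H y := by
  have C0 : 0 ≤ C := (abs_nonneg _).trans (hC 0 le_rfl)
  have fc : Continuous (fun t => exp (-t) * H t) := by fun_prop
  obtain ⟨J, hJ⟩ : ∃ J : ℝ → ℝ, J = fun t => ∫ s in (0:ℝ)..t, exp (-s) * H s := ⟨_, rfl⟩
  have Jd : ∀ t, HasDerivAt J (exp (-t) * H t) t := fun t => by
    rw [hJ]
    exact intervalIntegral.integral_hasDerivAt_right (fc.intervalIntegrable _ _)
      fc.stronglyMeasurable.stronglyMeasurableAtFilter fc.continuousAt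
  have i1 := aux_bdd_int (aux_exp_pow_int 1 one_pos) Hc hC
  have i2 := aux_bdd_int (aux_exp_pow_int 2 two_pos) Hc hC
  have i3 := aux_bdd_int (aux_exp_pow_int 3 three_pos) Hc hC
  have i1' : IntegrableOn (fun t => exp (-t) * H t) (Ioi 0) := by simpa using i1
  obtain ⟨L, hL⟩ : ∃ L, L = ∫ t in Ioi (0:ℝ), exp (-t) * H t := ⟨_, rfl⟩
  have Jt : Tendsto J atTop (𝓝 L) := by
    rw [hJ, hL]
    exact intervalIntegral_tendsto_integral_Ioi 0 i1' tendsto_id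
  have inner : ∀ y ∈ Ioi (0:ℝ), ∫ x in Ioi (0:ℝ), exp (-(x + y)) * H (x + y) = L - J y := by
    intro y hy
    have hy' : 0 < y := hy
    have := integral_Ioi_of_hasDerivAt_of_tendsto' (a := 0) (m := L)
      (f := fun x => J (x + y)) (f' := fun x => exp (-(x + y)) * H (x + y))
      (fun x _ => (Jd (x + y)).comp_add_const x y) ?_
      (Jt.comp (tendsto_atTop_add_const_right _ y tendsto_id))
    · simpa using this
    · have := aux_bdd_int (aux_exp_pow_int 1 one_pos) (H := fun x => exp (-y) * H (x + y))
        (C := 1 * C) (by fun_prop) (fun x hx => by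
          rw [abs_mul]
          refine mul_le_mul ?_ (hC _ (by linarith)) (abs_nonneg _) zero_le_one
          simpa using aux_exp_bdd 1 y hy'.le)
      refine this.congr_fun (fun x _ => ?_) measurableSet_Ioi
      simp only [neg_add, exp_add, pow_one]; ring
  have e1 : ∫ y in Ioi (0:ℝ), (exp (-y) ^ 1 - exp (-y) ^ 2) *
        ∫ x in Ioi (0:ℝ), exp (-(x + y)) * H (x + y)
      = ∫ y in Ioi (0:ℝ), (exp (-y) ^ 1 - exp (-y) ^ 2) * (L - J y) :=
    setIntegral_congr_fun measurableSet_Ioi (fun y hy => by rw [inner y hy])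
  have Jc : Continuous J := continuous_iff_continuousAt.2 fun y => (Jd y).continuousAt
  have JB : ∀ y, 0 ≤ y → |L - J y| ≤ C := by
    intro y hy
    rw [hL, hJ]
    beta_reduce
    rw [← intervalIntegral.integral_Ioi_sub_Ioi i1' hy, sub_sub_cancel]
    have : ∫ t in Ioi y, C * exp (-t) = C * exp (-y) := by
      rw [integral_const_mul, integral_exp_neg_Ioi]
    have bd : ‖∫ t in Ioi y, exp (-t) * H t‖ ≤ ∫ t in Ioi y, C * exp (-t) := by
      refine norm_integral_le_of_norm_le ?_ ?_
      · have := (aux_exp_pow_int 1 one_pos).const_mul C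
        simp only [pow_one] at this
        exact IntegrableOn.mono_set this (Ioi_subset_Ioi hy)
      · filter_upwards [ae_restrict_mem measurableSet_Ioi] with t ht
        have : y < t := ht
        rw [norm_mul, mul_comm]
        simp only [norm_eq_abs, abs_exp]
        gcongr
        exact hC t (by linarith)
    refine bd.trans (this.le.trans ?_)
    · have := aux_exp_bdd 1 y hy
      simp only [pow_one, abs_exp] at this
      nlinarith
  have iJ : IntegrableOn (fun y => (exp (-y) ^ 1 - exp (-y) ^ 2) * (L - J y)) (Ioi 0) :=
    aux_bdd_int ((aux_exp_pow_int 1 one_pos).sub (aux_exp_pow_int 2 two_pos)) (by fun_prop) JB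
  have iQ : IntegrableOn (fun y => 1 / 2 * (exp (-y) ^ 1 * H y) - exp (-y) ^ 2 * H y
      + 1 / 2 * (exp (-y) ^ 3 * H y)) (Ioi 0) := ((i1.const_mul _).sub i2).add (i3.const_mul _)
  have key := integral_Ioi_of_hasDerivAt_of_tendsto' (a := 0) (m := (1 / 2 - 0 + 1 / 2 * 0) * (L - L))
    (f := fun y => (1 / 2 - exp (-y) ^ 1 + 1 / 2 * exp (-y) ^ 2) * (L - J y))
    (f' := fun y => (exp (-y) ^ 1 - exp (-y) ^ 2) * (L - J y)
      - (1 / 2 * (exp (-y) ^ 1 * H y) - exp (-y) ^ 2 * H y + 1 / 2 * (exp (-y) ^ 3 * H y)))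
    (fun y _ => by
      refine ((((aux_exp_deriv 1 y).const_sub (1 / 2)).fun_add
        ((aux_exp_deriv 2 y).const_mul (1 / 2))).fun_mul ((Jd y).const_sub L)).congr_deriv ?_
      push_cast; ring)
    (iJ.sub iQ)
    (((tendsto_const_nhds.sub (aux_exp_tendsto 1 one_pos)).add
      ((aux_exp_tendsto 2 two_pos).const_mul _)).mul (tendsto_const_nhds.sub Jt))
  have i12 : IntegrableOn (fun y => 1 / 2 * (exp (-y) ^ 1 * H y) - exp (-y) ^ 2 * H y) (Ioi 0) :=
    (i1.const_mul _).sub i2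
  rw [integral_sub iJ iQ, integral_add i12 (i3.const_mul _),
    integral_sub (i1.const_mul _) i2, integral_const_mul, integral_const_mul] at key
  norm_num at key
  rw [e1]
  norm_num
  linarith

/-- the integrand -/
noncomputable def auxF (a p u q P v R θ : ℝ) : ℝ :=
  (a + θ * p) * ((1 - u + θ * P) * (1 - (1 - u + θ * P)) * (u + θ * q) * (v - θ * R))

/-- its derivative in `θ` -/
noncomputable def auxD (a p u q P v R θ : ℝ) : ℝ :=
  p * ((1 - u + θ * P) * (1 - (1 - u + θ * P)) * (u + θ * q) * (v - θ * R)) +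
  (a + θ * p) * (P * (1 - (1 - u + θ * P)) * (u + θ * q) * (v - θ * R)
    + (1 - u + θ * P) * (-P) * (u + θ * q) * (v - θ * R)
    + (1 - u + θ * P) * (1 - (1 - u + θ * P)) * q * (v - θ * R)
    + (1 - u + θ * P) * (1 - (1 - u + θ * P)) * (u + θ * q) * (-R))

lemma auxF_deriv (a p u q P v R θ : ℝ) :
    HasDerivAt (auxF a p u q P v R) (auxD a p u q P v R θ) θ := by
  have l (c d : ℝ) : HasDerivAt (fun θ : ℝ => c + θ * d) d θ := by
    simpa using ((hasDerivAt_id θ).mul_const d).const_add c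
  have l' (c d : ℝ) : HasDerivAt (fun θ : ℝ => c - θ * d) (-d) θ := by
    simpa using ((hasDerivAt_id θ).mul_const d).const_sub c
  have := (l a p).fun_mul ((((l (1 - u) P).fun_mul ((l (1 - u) P).const_sub 1)).fun_mul (l u q)).fun_mul (l' v R))
  refine this.congr_deriv ?_
  unfold auxD; ring

lemma aux_prod_bound {a b c d e A B : ℝ} (hA : 0 ≤ A) (hB : 0 ≤ B) {K : ℝ} (ha : |a| ≤ A) (hb : |b| ≤ K)
    (hc : |c| ≤ K) (hd : |d| ≤ B) (he : |e| ≤ K) : |a * (b * c * d * e)| ≤ K ^ 3 * (A * B) := by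
  have hK : 0 ≤ K := (abs_nonneg _).trans hb
  simp only [abs_mul]
  calc |a| * (|b| * |c| * |d| * |e|) ≤ A * (K * K * B * K) := by gcongr
    _ = _ := by ring

lemma auxF_bounds {a p u q P v R θ C : ℝ} (ha : 0 ≤ a) (hu : 0 ≤ u) (hu1 : u ≤ 1) (hv : 0 ≤ v)
    (hv1 : v ≤ 1) (hP : |P| ≤ C) (hR : |R| ≤ C) (hθ : |θ| ≤ 1) :
    |auxF a p u q P v R θ| ≤ (1 + C) ^ 3 * ((a + |p|) * (u + |q|)) ∧
    |auxD a p u q P v R θ| ≤ 5 * (1 + C) ^ 3 * ((a + |p|) * (u + |q|)) := by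
  have m {z w : ℝ} (hz : |z| ≤ w) : |θ * z| ≤ w := by
    rw [abs_mul]; nlinarith [abs_nonneg z, abs_nonneg θ]
  have hA : 0 ≤ a + |p| := by positivity
  have hB : 0 ≤ u + |q| := by positivity
  have g1 : |a + θ * p| ≤ a + |p| := (abs_add_le _ _).trans (by
    rw [abs_of_nonneg ha]; linarith [m (le_refl |p|)])
  have g2 : |u + θ * q| ≤ u + |q| := (abs_add_le _ _).trans (by
    rw [abs_of_nonneg hu]; linarith [m (le_refl |q|)])
  have p1 : |p| ≤ a + |p| := by linarith
  have q1 : |q| ≤ u + |q| := by linarith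
  have k1 : |1 - u + θ * P| ≤ 1 + C := by
    have := abs_le.1 (m hP); rw [abs_le]; constructor <;> linarith
  have k2 : |1 - (1 - u + θ * P)| ≤ 1 + C := by
    have := abs_le.1 (m hP); rw [abs_le]; constructor <;> linarith
  have k3 : |v - θ * R| ≤ 1 + C := by
    have := abs_le.1 (m hR); rw [abs_le]; constructor <;> linarith
  have k4 : |P| ≤ 1 + C := by linarith
  have k5 : |(-P)| ≤ 1 + C := by rw [abs_neg]; linarith
  have k6 : |(-R)| ≤ 1 + C := by rw [abs_neg]; linarith
  refine ⟨aux_prod_bound hA hB g1 k1 k2 g2 k3, ?_⟩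
  unfold auxD
  simp only [mul_add (a + θ * p)]
  have t1 := aux_prod_bound hA hB p1 k1 k2 g2 k3
  have t2 := aux_prod_bound hA hB g1 k4 k2 g2 k3
  have t3 := aux_prod_bound hA hB g1 k1 k5 g2 k3
  have t4 := aux_prod_bound hA hB g1 k1 k2 q1 k3
  have t5 := aux_prod_bound hA hB g1 k1 k2 g2 k6
  refine (abs_add_le _ _).trans ?_
  have := abs_add_three (((a + θ * p) * (P * (1 - (1 - u + θ * P)) * (u + θ * q) * (v - θ * R))) +
    ((a + θ * p) * ((1 - u + θ * P) * (-P) * (u + θ * q) * (v - θ * R))))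
    ((a + θ * p) * ((1 - u + θ * P) * (1 - (1 - u + θ * P)) * q * (v - θ * R)))
    ((a + θ * p) * ((1 - u + θ * P) * (1 - (1 - u + θ * P)) * (u + θ * q) * (-R)))
  have := abs_add_le ((a + θ * p) * (P * (1 - (1 - u + θ * P)) * (u + θ * q) * (v - θ * R)))
    ((a + θ * p) * ((1 - u + θ * P) * (-P) * (u + θ * q) * (v - θ * R)))
  linarith

lemma aux_core {h H : ℝ → ℝ} {C : ℝ} (hc : Continuous h) (hi : IntegrableOn h (Ioi 0))
    (hH : ∀ y, HasDerivAt H (h y) y) (H0 : H 0 = 0) (hC : ∀ y, 0 ≤ y → |H y| ≤ C) :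
    HasDerivAt (fun θ => ∫ x in Ioi (0:ℝ), ∫ y in Ioi (0:ℝ),
      auxF (exp (-x)) (h x) (exp (-y)) (h y) (H y) (exp (-(x + y))) (H (x + y)) θ)
      (-(5 / 12) * (∫ y in Ioi (0:ℝ), h y * exp (-y) ^ 1)
        + 3 / 4 * (∫ y in Ioi (0:ℝ), h y * exp (-y) ^ 2)
        - 1 / 3 * (∫ y in Ioi (0:ℝ), h y * exp (-y) ^ 3)) 0 := by
  have Hc : Continuous H := continuous_iff_continuousAt.2 fun y => (hH y).continuousAt
  obtain ⟨μ, hμ⟩ : ∃ μ : Measure ℝ, μ = volume.restrict (Ioi 0) := ⟨_, rfl⟩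
  have : SFinite μ := by rw [hμ]; infer_instance
  have hpos : ∀ᵐ p ∂(μ.prod μ), 0 < p.1 ∧ 0 < p.2 := by
    rw [hμ, Measure.prod_restrict]
    filter_upwards [ae_restrict_mem (measurableSet_Ioi.prod measurableSet_Ioi)] with p hp
    exact hp
  let F : ℝ → ℝ × ℝ → ℝ := fun θ p => auxF (exp (-p.1)) (h p.1) (exp (-p.2)) (h p.2) (H p.2)
    (exp (-(p.1 + p.2))) (H (p.1 + p.2)) θ
  let D : ℝ → ℝ × ℝ → ℝ := fun θ p => auxD (exp (-p.1)) (h p.1) (exp (-p.2)) (h p.2) (H p.2)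
    (exp (-(p.1 + p.2))) (H (p.1 + p.2)) θ
  have Fc (θ) : Continuous (F θ) := by simp only [F, auxF]; fun_prop
  have Dc (θ) : Continuous (D θ) := by simp only [D, auxD]; fun_prop
  have e1 : Integrable (fun x => exp (-x)) μ := by
    have := aux_exp_pow_int 1 one_pos
    simp only [pow_one] at this
    rw [hμ]; exact this
  have hi' : Integrable h μ := by rw [hμ]; exact hi
  have ki : Integrable (fun x => exp (-x) + |h x|) μ := e1.add hi'.abs
  have kk := ki.mul_prod ki
  have bounds : ∀ᵐ p ∂(μ.prod μ), ∀ θ ∈ Metric.ball (0:ℝ) 1,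
      |F θ p| ≤ (1 + C) ^ 3 * ((exp (-p.1) + |h p.1|) * (exp (-p.2) + |h p.2|)) ∧
      |D θ p| ≤ 5 * (1 + C) ^ 3 * ((exp (-p.1) + |h p.1|) * (exp (-p.2) + |h p.2|)) := by
    filter_upwards [hpos] with p hp θ hθ
    have hθ' : |θ| < 1 := by simpa using hθ
    exact auxF_bounds (exp_nonneg _) (exp_nonneg _) (exp_le_one_iff.2 (by linarith)) (exp_nonneg _)
      (exp_le_one_iff.2 (by linarith)) (hC _ hp.2.le) (hC _ (by linarith)) hθ'.le
  have Fi : ∀ θ ∈ Metric.ball (0:ℝ) 1, Integrable (F θ) (μ.prod μ) := fun θ hθ =>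
    (kk.const_mul ((1 + C) ^ 3)).mono' (Fc θ).aestronglyMeasurable
      (by filter_upwards [bounds] with p hp using (hp θ hθ).1)
  have ball := Metric.ball_mem_nhds (0:ℝ) one_pos
  obtain ⟨Di, hd⟩ := hasDerivAt_integral_of_dominated_loc_of_deriv_le (F := F) (F' := D)
    (μ := μ.prod μ) ball
    (Eventually.of_forall fun θ => (Fc θ).aestronglyMeasurable)
    (Fi 0 (by simp)) (Dc 0).aestronglyMeasurable
    (by filter_upwards [bounds] with p hp θ hθ using (hp θ hθ).2)
    (kk.const_mul (5 * (1 + C) ^ 3))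
    (Eventually.of_forall fun p θ _ => auxF_deriv _ _ _ _ _ _ _ _)
  have hd2 := hd.congr_of_eventuallyEq (f₁ := fun θ => ∫ x in Ioi (0:ℝ), ∫ y in Ioi (0:ℝ),
      auxF (exp (-x)) (h x) (exp (-y)) (h y) (H y) (exp (-(x + y))) (H (x + y)) θ) (by
    filter_upwards [ball] with θ hθ
    rw [integral_prod _ (Fi θ hθ), hμ])
  refine hd2.congr_deriv ?_
  -- compute the integral
  have q1 := aux_exp_pow_int 1 one_pos
  have q2 := aux_exp_pow_int 2 two_pos
  have q3 := aux_exp_pow_int 3 three_pos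
  have q4 := aux_exp_pow_int 4 four_pos
  have r2 := aux_bdd_int q2 Hc hC
  have r3 := aux_bdd_int q3 Hc hC
  have s1 := aux_hexp_int hi 1
  have s2 := aux_hexp_int hi 2
  have s3 := aux_hexp_int hi 3
  have iA : Integrable (fun y => exp (-y) ^ 3 - exp (-y) ^ 4) μ := by rw [hμ]; exact q3.sub q4
  have ir : Integrable (fun y => 2 * (exp (-y) ^ 3 * H y) - exp (-y) ^ 2 * H y) μ := by
    rw [hμ]; exact (r3.const_mul 2).sub r2
  have is : Integrable (fun y => h y * exp (-y) ^ 2 - h y * exp (-y) ^ 3) μ := by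
    rw [hμ]; exact s2.sub s3
  have iB : Integrable (fun y => (2 * (exp (-y) ^ 3 * H y) - exp (-y) ^ 2 * H y)
      + (h y * exp (-y) ^ 2 - h y * exp (-y) ^ 3)) μ := ir.add is
  have ih1 : Integrable (fun x => h x * exp (-x) ^ 1) μ := by rw [hμ]; exact s1
  have ie2 : Integrable (fun x => exp (-x) ^ 2) μ := by rw [hμ]; exact q2
  have p1 := ih1.mul_prod iA
  have p2 := ie2.mul_prod iB
  have p12 : Integrable (fun p : ℝ × ℝ => (h p.1 * exp (-p.1) ^ 1) * (exp (-p.2) ^ 3 - exp (-p.2) ^ 4)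
      + exp (-p.1) ^ 2 * ((2 * (exp (-p.2) ^ 3 * H p.2) - exp (-p.2) ^ 2 * H p.2)
      + (h p.2 * exp (-p.2) ^ 2 - h p.2 * exp (-p.2) ^ 3))) (μ.prod μ) := p1.add p2
  let T : ℝ × ℝ → ℝ := fun p => (exp (-p.2) ^ 1 - exp (-p.2) ^ 2) * (exp (-(p.1 + p.2)) * H (p.1 + p.2))
  have Dsplit : D 0 = fun p => (h p.1 * exp (-p.1) ^ 1) * (exp (-p.2) ^ 3 - exp (-p.2) ^ 4)
      + exp (-p.1) ^ 2 * ((2 * (exp (-p.2) ^ 3 * H p.2) - exp (-p.2) ^ 2 * H p.2)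
      + (h p.2 * exp (-p.2) ^ 2 - h p.2 * exp (-p.2) ^ 3)) - T p := by
    funext p
    simp only [D, auxD, T, neg_add, exp_add]; ring
  have Ti : Integrable T (μ.prod μ) := by
    have := p12.sub Di
    refine this.congr (Eventually.of_forall fun p => ?_)
    simp only [Pi.sub_apply, Dsplit]; ring
  have Tv : ∫ p, T p ∂(μ.prod μ) = 1 / 2 * (∫ y in Ioi (0:ℝ), exp (-y) ^ 1 * H y)
      - (∫ y in Ioi (0:ℝ), exp (-y) ^ 2 * H y) + 1 / 2 * ∫ y in Ioi (0:ℝ), exp (-y) ^ 3 * H y := by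
    rw [integral_prod_symm _ Ti, ← aux_T3 Hc hC, hμ]
    simp only [T, integral_const_mul]
  rw [Dsplit, integral_sub p12 Ti, integral_add p1 p2,
    integral_prod_mul (fun x => h x * exp (-x) ^ 1) (fun y => exp (-y) ^ 3 - exp (-y) ^ 4), Tv,
    integral_prod_mul (fun x => exp (-x) ^ 2) (fun y => (2 * (exp (-y) ^ 3 * H y) - exp (-y) ^ 2 * H y)
      + (h y * exp (-y) ^ 2 - h y * exp (-y) ^ 3)), integral_add ir is, hμ,
    integral_sub q3 q4, integral_sub s2 s3, integral_sub (r3.const_mul 2) r2, integral_const_mul,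
    aux_parts hi hH H0 hC 1 one_pos, aux_parts hi hH H0 hC 2 two_pos,
    aux_parts hi hH H0 hC 3 three_pos, aux_exp_pow_val 2 two_pos, aux_exp_pow_val 3 three_pos,
    aux_exp_pow_val 4 four_pos]
  push_cast
  ring

/-- Derivative at `θ = 0` of the limit-in-probability function `b(θ)` built from the
perturbed density `g(x,θ) = e^{−x} + θh(x)`. -/
theorem stmt_5 (h : ℝ → ℝ)
    (hbd : ∃ M : ℝ, ∀ x, 0 ≤ x → |h x| ≤ M)
    (hcont : ContinuousOn h (Ici 0))
    (hint : IntegrableOn h (Ioi 0))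
    (hzero : (∫ x in Ioi (0:ℝ), h x) = 0)
    (hxh : IntegrableOn (fun x => x * h x) (Ioi 0))
    (H : ℝ → ℝ) (Hdef : ∀ y, H y = ∫ s in (0:ℝ)..y, h s)
    (g : ℝ → ℝ → ℝ) (gdef : ∀ θ x, g θ x = exp (-x) + θ * h x)
    (G : ℝ → ℝ → ℝ) (Gdef : ∀ θ y, G θ y = 1 - exp (-y) + θ * H y)
    (b : ℝ → ℝ)
    (bdef : ∀ θ, b θ = 1/4 - 6 * ∫ x in Ioi (0:ℝ), g θ x *
        ∫ y in Ioi (0:ℝ), G θ y * (1 - G θ y) * g θ y * (∫ z in Ioi (x + y), g θ z)) :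
    HasDerivAt b
      (∫ s in Ioi (0:ℝ),
        h s * (-1 + 2 * exp (-(3*s)) - (9/2) * exp (-(2*s)) + (5/2) * exp (-s))) 0 ∧
    (∫ s in Ioi (0:ℝ),
        h s * (-1 + 2 * exp (-(3*s)) - (9/2) * exp (-(2*s)) + (5/2) * exp (-s))) =
      5 * ∫ s in Ioi (0:ℝ), psi s * h s := by
  have hE : ∀ s : ℝ, h s * (-1 + 2 * exp (-(3*s)) - (9/2) * exp (-(2*s)) + (5/2) * exp (-s))
      = -1 * h s + 2 * (h s * exp (-s) ^ 3) - 9 / 2 * (h s * exp (-s) ^ 2)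
        + 5 / 2 * (h s * exp (-s) ^ 1) := fun s => by
    rw [show -(3*s) = ((3:ℕ):ℝ) * (-s) by push_cast; ring, exp_nat_mul,
      show -(2*s) = ((2:ℕ):ℝ) * (-s) by push_cast; ring, exp_nat_mul]; ring
  have hpsi : ∀ s : ℝ, psi s * h s
      = -1 / 20 * h s + 2 / 5 * (h s * exp (-s) ^ 3) - 9 / 10 * (h s * exp (-s) ^ 2)
        + 1 / 2 * (h s * exp (-s) ^ 1) := fun s => by
    unfold psi
    rw [show -(3*s) = ((3:ℕ):ℝ) * (-s) by push_cast; ring, exp_nat_mul,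
      show -(2*s) = ((2:ℕ):ℝ) * (-s) by push_cast; ring, exp_nat_mul]; ring
  have s1 := aux_hexp_int hint 1
  have s2 := aux_hexp_int hint 2
  have s3 := aux_hexp_int hint 3
  have comb : ∀ a b c d : ℝ, ∫ s in Ioi (0:ℝ), (a * h s + b * (h s * exp (-s) ^ 3)
      - c * (h s * exp (-s) ^ 2) + d * (h s * exp (-s) ^ 1))
      = b * (∫ s in Ioi (0:ℝ), h s * exp (-s) ^ 3) - c * (∫ s in Ioi (0:ℝ), h s * exp (-s) ^ 2)
      + d * (∫ s in Ioi (0:ℝ), h s * exp (-s) ^ 1) := by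
    intro a b c d
    have t1 : IntegrableOn (fun s => a * h s + b * (h s * exp (-s) ^ 3)) (Ioi 0) :=
      (hint.const_mul a).add (s3.const_mul b)
    have t2 : IntegrableOn (fun s => a * h s + b * (h s * exp (-s) ^ 3)
      - c * (h s * exp (-s) ^ 2)) (Ioi 0) := t1.sub (s2.const_mul c)
    rw [integral_add t2 (s1.const_mul d), integral_sub t1 (s2.const_mul c),
      integral_add (hint.const_mul a) (s3.const_mul b)]
    simp only [integral_const_mul, hzero]
    ring
  simp only [hE, hpsi, comb]
  refine ⟨?_, by ring⟩
  -- continuous extension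
  obtain ⟨k, hk⟩ : ∃ k : ℝ → ℝ, k = fun x => h (max x 0) := ⟨_, rfl⟩
  have kh : ∀ x, 0 ≤ x → k x = h x := fun x hx => by rw [hk]; simp only [max_eq_left hx]
  have kc : Continuous k := by
    rw [hk]
    exact hcont.comp_continuous (by fun_prop) (fun x => mem_Ici.2 (le_max_right _ _))
  have ki : IntegrableOn k (Ioi 0) :=
    hint.congr_fun (fun x hx => (kh x (le_of_lt hx)).symm) measurableSet_Ioi
  obtain ⟨K, hK⟩ : ∃ K : ℝ → ℝ, K = fun y => ∫ s in (0:ℝ)..y, k s := ⟨_, rfl⟩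
  have Kd : ∀ y, HasDerivAt K (k y) y := fun y => by
    rw [hK]
    exact intervalIntegral.integral_hasDerivAt_right (kc.intervalIntegrable _ _)
      kc.stronglyMeasurable.stronglyMeasurableAtFilter kc.continuousAt
  have K0 : K 0 = 0 := by rw [hK]; simp
  have KH : ∀ y, 0 ≤ y → H y = K y := fun y hy => by
    rw [Hdef, hK]
    refine intervalIntegral.integral_congr (fun s hs => ?_)
    rw [uIcc_of_le hy] at hs
    exact (kh s hs.1).symm
  have tail : ∀ t, 0 ≤ t → ∫ z in Ioi t, h z = - H t := fun t ht => by
    rw [Hdef, ← intervalIntegral.integral_Ioi_sub_Ioi hint ht, hzero]; ring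
  have KC : ∀ y, 0 ≤ y → |K y| ≤ ∫ s in Ioi (0:ℝ), |h s| := fun y hy => by
    rw [← KH y hy, ← abs_neg, ← tail y hy]
    refine (abs_integral_le_integral_abs).trans ?_
    exact setIntegral_mono_set hint.abs (Eventually.of_forall fun x => abs_nonneg _)
      (Ioi_subset_Ioi hy).eventuallyLE
  have core := aux_core kc ki Kd K0 KC
  have kE : ∀ n : ℕ, ∫ y in Ioi (0:ℝ), k y * exp (-y) ^ n = ∫ y in Ioi (0:ℝ), h y * exp (-y) ^ n :=
    fun n => setIntegral_congr_fun measurableSet_Ioi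
      (fun y hy => by simp only [kh y (le_of_lt hy)])
  rw [kE, kE, kE] at core
  have bE : b = fun θ => 1 / 4 - 6 * ∫ x in Ioi (0:ℝ), ∫ y in Ioi (0:ℝ),
      auxF (exp (-x)) (k x) (exp (-y)) (k y) (K y) (exp (-(x + y))) (K (x + y)) θ := by
    funext θ
    rw [bdef]
    congr 2
    refine setIntegral_congr_fun measurableSet_Ioi (fun x hx => ?_)
    have hx' : 0 < x := hx
    rw [← integral_const_mul]
    refine setIntegral_congr_fun measurableSet_Ioi (fun y hy => ?_)
    have hy' : 0 < y := hy
    have hxy : 0 ≤ x + y := by linarith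
    have tl : ∫ z in Ioi (x + y), g θ z = exp (-(x + y)) - θ * K (x + y) := by
      simp only [gdef]
      have e1 : IntegrableOn (fun z : ℝ => exp (-z)) (Ioi (x + y)) := by
        have := (aux_exp_pow_int 1 one_pos).mono_set (Ioi_subset_Ioi hxy)
        simpa using this
      rw [integral_add e1 ((hint.mono_set (Ioi_subset_Ioi hxy)).const_mul θ), integral_const_mul,
        integral_exp_neg_Ioi, tail _ hxy, KH _ hxy]
      ring
    rw [tl]
    simp only [gdef, Gdef, auxF, kh x hx'.le, kh y hy'.le, KH y hy'.le]
  rw [bE]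
  refine ((core.const_mul 6).const_sub (1 / 4)).congr_deriv ?_
  ring
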